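/- Over the graded polynomial ring S = k[x_1,...,x_n], if M and M' are graded Cohen–Macaulay S-modules with pure resolutions of types d and d' respectively, and there exists a nonzero homogeneous homomorphism M' → M of degree ≤ 0, then d_i ≤ d'_i for all i (in particular the lengths satisfy ℓ(d') ≤ ℓ(d)). -/

import Mathlib

/-- The degree-`j` homogeneous component (over `k`) of the shifted graded free module
`S(-e)^m` over `S = k[x₁,…,xₙ]`: vectors of homogeneous polynomials of degree `j - e`. -/
noncomputable def freeGr (k : Type*) [Field k] (n : ℕ) (e : ℤ) (m : ℕ) (j : ℤ) :
    Submodule k (Fin m → MvPolynomial (Fin n) k) :=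
  if 0 ≤ j - e then
    Submodule.pi Set.univ
      (fun _ => MvPolynomial.homogeneousSubmodule (Fin n) k (j - e).toNat)
  else ⊥

/-- A (ℤ-)graded module over `S = k[x₁,…,xₙ]`: an internal direct sum decomposition into
`k`-subspaces compatible with multiplication by homogeneous polynomials. -/
structure GradedMod (k : Type*) [Field k] (n : ℕ) (M : Type*) [AddCommGroup M]
    [Module (MvPolynomial (Fin n) k) M] [Module k M]
    [IsScalarTower k (MvPolynomial (Fin n) k) M] where
  gr : ℤ → Submodule k M
  internal : DirectSum.IsInternal gr
  smul_mem : ∀ (i : ℕ) (p : MvPolynomial (Fin n) k),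
    p ∈ MvPolynomial.homogeneousSubmodule (Fin n) k i →
    ∀ (j : ℤ) (m : M), m ∈ gr j → p • m ∈ gr ((i : ℤ) + j)

/-- A pure (necessarily minimal) graded free resolution of type `d` and length `ℓ` of a
graded module `M`:  an exact complex `0 ← M ← F₀ ← F₁ ← ⋯ ← F_ℓ ← 0` of graded free
`S`-modules, where `F_i` is a nonzero free module generated entirely in the single degree
`d_i`, and `d₀ < d₁ < ⋯ < d_ℓ`. -/
structure PureRes (k : Type*) [Field k] (n : ℕ) (M : Type*) [AddCommGroup M]
    [Module (MvPolynomial (Fin n) k) M] [Module k M]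
    [IsScalarTower k (MvPolynomial (Fin n) k) M]
    (gM : GradedMod k n M) (ℓ : ℕ) (d : ℕ → ℤ) where
  b : ℕ → ℕ
  bpos : ∀ i ≤ ℓ, 0 < b i
  bzero : ∀ i, ℓ < i → b i = 0
  dmono : ∀ i < ℓ, d i < d (i + 1)
  ε : (Fin (b 0) → MvPolynomial (Fin n) k) →ₗ[MvPolynomial (Fin n) k] M
  δ : ∀ i : ℕ, (Fin (b (i + 1)) → MvPolynomial (Fin n) k)
        →ₗ[MvPolynomial (Fin n) k] (Fin (b i) → MvPolynomial (Fin n) k)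
  ε_surj : Function.Surjective ε
  ε_hom : ∀ (j : ℤ) (v : Fin (b 0) → MvPolynomial (Fin n) k),
    v ∈ freeGr k n (d 0) (b 0) j → ε v ∈ gM.gr j
  δ_hom : ∀ (i : ℕ) (j : ℤ) (v : Fin (b (i + 1)) → MvPolynomial (Fin n) k),
    v ∈ freeGr k n (d (i + 1)) (b (i + 1)) j → δ i v ∈ freeGr k n (d i) (b i) j
  exact0 : LinearMap.ker ε = LinearMap.range (δ 0)
  exact : ∀ i : ℕ, LinearMap.ker (δ i) = LinearMap.range (δ (i + 1))


theorem lift_free {R : Type*} [CommRing R] {m : ℕ} {P N : Type*} [AddCommGroup P] [Module R P]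
    [AddCommGroup N] [Module R N] (g : P →ₗ[R] N) (f : (Fin m → R) →ₗ[R] N) (Q : P → Prop)
    (h : ∀ i, ∃ p, Q p ∧ g p = f (Pi.single i 1)) :
    ∃ u : (Fin m → R) →ₗ[R] P, g ∘ₗ u = f ∧ ∀ i, Q (u (Pi.single i 1)) := by
  choose p hp hgp using h
  refine ⟨(Pi.basisFun R (Fin m)).constr R p, ?_, ?_⟩
  · apply (Pi.basisFun R (Fin m)).ext
    intro i
    rw [LinearMap.comp_apply, Module.Basis.constr_basis, hgp, Pi.basisFun_apply]
  · intro i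
    have := (Pi.basisFun R (Fin m)).constr_basis R p i
    rw [Pi.basisFun_apply] at this
    rw [this]; exact hp i

theorem lift_free' {R : Type*} [CommRing R] {m : ℕ} {P N : Type*} [AddCommGroup P] [Module R P]
    [AddCommGroup N] [Module R N] (g : P →ₗ[R] N) (f : (Fin m → R) →ₗ[R] N)
    (h : ∀ x, ∃ p, g p = f x) :
    ∃ u : (Fin m → R) →ₗ[R] P, g ∘ₗ u = f := by
  obtain ⟨u, hu, -⟩ := lift_free g f (fun _ => True) (fun i => by simpa using h _)
  exact ⟨u, hu⟩

section
open scoped Pointwise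
variable {R : Type*} [CommRing R] (b : ℕ → ℕ)
  (δ : ∀ i, (Fin (b (i+1)) → R) →ₗ[R] (Fin (b i) → R))
  {M : Type*} [AddCommGroup M] [Module R M] (ε : (Fin (b 0) → R) →ₗ[R] M)
  (e0 : LinearMap.ker ε = LinearMap.range (δ 0))
  (e : ∀ i, LinearMap.ker (δ i) = LinearMap.range (δ (i+1)))

theorem homotopy_aux (e0 : LinearMap.ker ε = LinearMap.range (δ 0))
    (e : ∀ i, LinearMap.ker (δ i) = LinearMap.range (δ (i+1)))
    (r : R) (hr : r ∈ Module.annihilator R M) :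
    (∃ s : (Fin (b 0) → R) →ₗ[R] (Fin (b 1) → R), ∀ x, δ 0 (s x) = r • x) ∧
    ∀ j, ∃ (s : (Fin (b j) → R) →ₗ[R] (Fin (b (j+1)) → R))
      (s' : (Fin (b (j+1)) → R) →ₗ[R] (Fin (b (j+1+1)) → R)),
      ∀ x, δ (j+1) (s' x) + s (δ j x) = r • x := by
  have h0 : ∃ s : (Fin (b 0) → R) →ₗ[R] (Fin (b 1) → R), ∀ x, δ 0 (s x) = r • x := by
    obtain ⟨s, hs⟩ := lift_free' (δ 0) (r • LinearMap.id) (by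
      intro x
      have : r • x ∈ LinearMap.ker ε := by
        rw [LinearMap.mem_ker, map_smul, Module.mem_annihilator.1 hr]
      rw [e0] at this
      simpa using this)
    exact ⟨s, fun x => by simpa using LinearMap.congr_fun hs x⟩
  have key : ∀ j (s : (Fin (b j) → R) →ₗ[R] (Fin (b (j+1)) → R)),
      (∀ x, δ j (s (δ j x)) = r • δ j x) →
      ∃ (s' : (Fin (b (j+1)) → R) →ₗ[R] (Fin (b (j+1+1)) → R)),
      ∀ x, δ (j+1) (s' x) + s (δ j x) = r • x := by
    intro j s hs
    obtain ⟨s', hs'⟩ := lift_free' (δ (j+1)) (r • LinearMap.id - s ∘ₗ δ j) (by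
      intro x
      have : r • x - s (δ j x) ∈ LinearMap.ker (δ j) := by
        rw [LinearMap.mem_ker, map_sub, map_smul, hs, sub_self]
      rw [e] at this
      simpa using this)
    refine ⟨s', fun x => ?_⟩
    have := LinearMap.congr_fun hs' x
    simp at this
    rw [this]; abel
  have cplx : ∀ j x, δ j (δ (j+1) x) = 0 := fun j x => by
    rw [← LinearMap.mem_ker, e]; exact ⟨x, rfl⟩
  refine ⟨h0, fun j => ?_⟩
  induction j with
  | zero =>
    obtain ⟨s, hs⟩ := h0
    obtain ⟨s', hs'⟩ := key 0 s (fun x => hs _)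
    exact ⟨s, s', hs'⟩
  | succ j ih =>
    obtain ⟨s, s', hs⟩ := ih
    obtain ⟨s'', hs''⟩ := key (j+1) s' (fun x => by
      have := hs (δ (j+1) x)
      rwa [cplx, map_zero, add_zero] at this)
    exact ⟨s', s'', hs''⟩

open RingTheory.Sequence in
theorem ext_vanish (e0 : LinearMap.ker ε = LinearMap.range (δ 0))
    (e : ∀ i, LinearMap.ker (δ i) = LinearMap.range (δ (i+1)))
    (rs : List R) {N : Type*} [AddCommGroup N] [Module R N] (hreg : IsWeaklyRegular N rs)
    (hann : ∀ r ∈ rs, r ∈ Module.annihilator R M) :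
    (0 < rs.length → ∀ g : (Fin (b 0) → R) →ₗ[R] N, (∀ x, g (δ 0 x) = 0) → g = 0) ∧
    ∀ j, j + 1 < rs.length → ∀ g : (Fin (b (j+1)) → R) →ₗ[R] N, (∀ x, g (δ (j+1) x) = 0) →
      ∃ h : (Fin (b j) → R) →ₗ[R] N, ∀ x, h (δ j x) = g x := by
  have cplx : ∀ j x, δ j (δ (j+1) x) = 0 := fun j x => by
    rw [← LinearMap.mem_ker, e]; exact ⟨x, rfl⟩
  induction rs generalizing N with
  | nil => exact ⟨fun h => by simp at h, fun j h => by simp at h⟩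
  | cons r rs ih =>
    rw [isWeaklyRegular_cons_iff] at hreg
    obtain ⟨hr, hreg⟩ := hreg
    obtain ⟨⟨s0, hs0⟩, hs⟩ := homotopy_aux b δ ε e0 e r (hann r (by simp))
    obtain ⟨ih0, ih1⟩ := ih hreg (fun r' h' => hann r' (by simp [h']))
    have div : ∀ {m : ℕ} (w : (Fin m → R) →ₗ[R] N),
        (∀ x, (Submodule.mkQ (r • (⊤ : Submodule R N))) (w x) = 0) →
        ∃ u : (Fin m → R) →ₗ[R] N, ∀ x, w x = r • u x := by
      intro m w hw
      obtain ⟨u, hu⟩ := lift_free' (r • (LinearMap.id : N →ₗ[R] N)) w (by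
        intro x
        have := hw x
        rw [Submodule.mkQ_apply, Submodule.Quotient.mk_eq_zero,
          Submodule.mem_smul_pointwise_iff_exists] at this
        obtain ⟨y, -, hy⟩ := this
        exact ⟨y, by simpa using hy⟩)
      exact ⟨u, fun x => by simpa using (LinearMap.congr_fun hu x).symm⟩
    refine ⟨fun _ g hg => ?_, fun j hj g hg => ?_⟩
    · refine LinearMap.ext fun x => hr ?_
      show r • g x = r • (0 : N)
      rw [← map_smul, ← hs0, smul_zero]
      exact hg _
    · obtain ⟨s, s', hss⟩ := hs j
      have hgs : ∀ x, g (s (δ j x)) = r • g x := by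
        intro x
        rw [← map_smul, ← hss, map_add, hg, zero_add]
      have hmk : ∀ x, (Submodule.mkQ (r • (⊤ : Submodule R N))) (g (s (δ j x))) = 0 := by
        intro x
        rw [hgs, Submodule.mkQ_apply, Submodule.Quotient.mk_eq_zero]
        exact Submodule.smul_mem_pointwise_smul _ _ _ trivial
      have hj' : j < rs.length := by simpa using hj
      cases j with
      | zero =>
        have := ih0 hj' (Submodule.mkQ (r • (⊤ : Submodule R N)) ∘ₗ g ∘ₗ s) hmk
        obtain ⟨u, hu⟩ := div (g ∘ₗ s) (fun x => LinearMap.congr_fun this x)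
        refine ⟨u, fun x => hr ?_⟩
        show r • u (δ 0 x) = r • g x
        rw [← hu, ← hgs]; rfl
      | succ j =>
        obtain ⟨h', hh'⟩ := ih1 j hj' (Submodule.mkQ (r • (⊤ : Submodule R N)) ∘ₗ g ∘ₗ s) hmk
        obtain ⟨h'', hh''⟩ := lift_free' (Submodule.mkQ (r • (⊤ : Submodule R N))) h'
          (fun x => Submodule.mkQ_surjective _ _)
        obtain ⟨u, hu⟩ := div (g ∘ₗ s - h'' ∘ₗ δ j) (fun x => by
          have h1 := hh' x
          have h2 := LinearMap.congr_fun hh'' (δ j x)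
          simp only [LinearMap.comp_apply, LinearMap.sub_apply, map_sub] at h1 h2 ⊢
          rw [h2, h1, sub_self])
        refine ⟨u, fun x => hr ?_⟩
        show r • u (δ (j+1) x) = r • g x
        rw [← hu, ← hgs]
        simp [cplx]

open RingTheory.Sequence in
theorem ext_vanish_pi (e0 : LinearMap.ker ε = LinearMap.range (δ 0))
    (e : ∀ i, LinearMap.ker (δ i) = LinearMap.range (δ (i+1)))
    (rs : List R) (m : ℕ) (hreg : IsWeaklyRegular R rs)
    (hann : ∀ r ∈ rs, r ∈ Module.annihilator R M) :
    (0 < rs.length → ∀ g : (Fin (b 0) → R) →ₗ[R] (Fin m → R), (∀ x, g (δ 0 x) = 0) → g = 0) ∧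
    ∀ j, j + 1 < rs.length → ∀ g : (Fin (b (j+1)) → R) →ₗ[R] (Fin m → R),
      (∀ x, g (δ (j+1) x) = 0) →
      ∃ h : (Fin (b j) → R) →ₗ[R] (Fin m → R), ∀ x, h (δ j x) = g x := by
  obtain ⟨h0, h1⟩ := ext_vanish b δ ε e0 e rs hreg hann
  refine ⟨fun hl g hg => ?_, fun j hj g hg => ?_⟩
  · refine LinearMap.ext fun x => funext fun a => ?_
    have := h0 hl (LinearMap.proj a ∘ₗ g) (fun x => by simp [hg])
    exact LinearMap.congr_fun this x
  · have := fun a => h1 j hj (LinearMap.proj a ∘ₗ g) (fun x => by simp [hg])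
    choose h hh using this
    exact ⟨LinearMap.pi h, fun x => funext fun a => by simpa using hh a x⟩

/-- Key: a chain map with `φ i = 0`, `i ≤ length of regular sequence` is zero on homology. -/
theorem chain_zero (e0 : LinearMap.ker ε = LinearMap.range (δ 0))
    (e : ∀ i, LinearMap.ker (δ i) = LinearMap.range (δ (i+1)))
    (rs : List R) (hreg : RingTheory.Sequence.IsWeaklyRegular R rs)
    (hann : ∀ r ∈ rs, r ∈ Module.annihilator R M)
    (b' : ℕ → ℕ) (δ' : ∀ i, (Fin (b' (i+1)) → R) →ₗ[R] (Fin (b' i) → R))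
    (cplx' : ∀ j x, δ' j (δ' (j+1) x) = 0)
    (φ : ∀ i, (Fin (b i) → R) →ₗ[R] (Fin (b' i) → R))
    (comm : ∀ i x, δ' i (φ (i+1) x) = φ i (δ i x))
    (i : ℕ) (hi : i ≤ rs.length) (h0 : φ i = 0) :
    ∃ u : (Fin (b 0) → R) →ₗ[R] (Fin (b' 1) → R), ∀ x, φ 0 x = δ' 0 (u x) := by
  have V := fun m => ext_vanish_pi b δ ε e0 e rs m hreg hann
  cases i with
  | zero => exact ⟨0, fun x => by simp [h0]⟩
  | succ i =>
    have Q : ∀ q j, j + q = i → ∃ u : (Fin (b j) → R) →ₗ[R] (Fin (b' (j+1)) → R),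
        ∀ x, (φ j - δ' j ∘ₗ u) (δ j x) = 0 := by
      intro q
      induction q with
      | zero =>
        rintro j rfl
        exact ⟨0, fun x => by simp [← comm, show φ (j+1) = 0 from h0]⟩
      | succ q ih =>
        intro j hj
        obtain ⟨u, hu⟩ := ih (j+1) (by omega)
        obtain ⟨h, hh⟩ := (V _).2 j (by omega) _ hu
        refine ⟨h, fun x => ?_⟩
        have c := comm j x
        rw [LinearMap.sub_apply, LinearMap.comp_apply, hh, LinearMap.sub_apply, map_sub, c,
          LinearMap.comp_apply, cplx', sub_zero, sub_self]
    obtain ⟨u, hu⟩ := Q i 0 (by omega)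
    have := (V _).1 (by omega) _ hu
    exact ⟨u, fun x => by simpa [sub_eq_zero] using LinearMap.congr_fun this x⟩
end

section NagataB
open Polynomial MvPolynomial Ideal Nat RingHom List

variable {k : Type*} [Field k] {n : ℕ} (f : MvPolynomial (Fin (n + 1)) k)
variable (v w : Fin (n + 1) →₀ ℕ)

/-- big number -/
abbrev nagUp : ℕ := 2 + f.totalDegree

/-- exponent -/
abbrev nagR (i : Fin (n + 1)) : ℕ := nagUp f ^ i.1

noncomputable abbrev nagT1 (c : k) :
    MvPolynomial (Fin (n + 1)) k →ₐ[k] MvPolynomial (Fin (n + 1)) k :=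
  aeval fun i ↦ if i = 0 then MvPolynomial.X 0
    else MvPolynomial.X i + c • MvPolynomial.X 0 ^ nagR f i

lemma nag_t1_comp_t1_neg (c : k) : (nagT1 f c).comp (nagT1 f (-c)) = AlgHom.id _ _ := by
  rw [comp_aeval, ← MvPolynomial.aeval_X_left]
  ext i v
  cases i using Fin.cases <;> simp

noncomputable abbrev nagT := AlgEquiv.ofAlgHom (nagT1 f 1) (nagT1 f (-1))
  (nag_t1_comp_t1_neg f 1) (by simpa using nag_t1_comp_t1_neg f (-1))

lemma nag_sum_r_mul_ne (vlt : ∀ i, v i < nagUp f) (wlt : ∀ i, w i < nagUp f) (ne : v ≠ w) :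
    ∑ x : Fin (n + 1), nagR f x * v x ≠ ∑ x : Fin (n + 1), nagR f x * w x := by
  intro h
  refine ne <| Finsupp.ext <| congrFun <| ofFn_inj.mp ?_
  apply ofDigits_inj_of_len_eq (Nat.lt_add_right f.totalDegree one_lt_two)
    (by simp) (by grind) (by grind)
  simpa only [ofDigits_eq_sum_mapIdx, mapIdx_eq_ofFn, get_ofFn, length_ofFn,
    Fin.val_cast, mul_comm, sum_ofFn] using! h

lemma nag_degreeOf_zero_t {a : k} (ha : a ≠ 0) : ((nagT f) (monomial v a)).degreeOf 0 =
    ∑ i : Fin (n + 1), (nagR f i) * v i := by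
  rw [← natDegree_finSuccEquiv, monomial_eq, Finsupp.prod_pow v fun a ↦ MvPolynomial.X a]
  simp only [Fin.prod_univ_succ, Fin.sum_univ_succ, map_mul, map_prod, map_pow,
    AlgEquiv.ofAlgHom_apply, MvPolynomial.aeval_C, MvPolynomial.aeval_X, if_pos, Fin.succ_ne_zero,
    ite_false, one_smul, map_add, finSuccEquiv_X_zero, finSuccEquiv_X_succ, algebraMap_eq]
  have h (i : Fin n) :
      (Polynomial.C (MvPolynomial.X (R := k) i) + Polynomial.X ^ nagR f i.succ) ^ v i.succ ≠ 0 :=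
    pow_ne_zero (v i.succ) (leadingCoeff_ne_zero.mp <| by simp [add_comm, leadingCoeff_X_pow_add_C])
  rw [natDegree_mul (by simp [ha]) (mul_ne_zero (by simp) (Finset.prod_ne_zero_iff.mpr
    (fun i _ ↦ h i))), natDegree_mul (by simp) (Finset.prod_ne_zero_iff.mpr (fun i _ ↦ h i)),
    natDegree_prod _ _ (fun i _ ↦ h i), natDegree_finSuccEquiv, degreeOf_C]
  simp only [natDegree_pow, zero_add, natDegree_X, mul_one]
  refine congrArg₂ (· + ·) (by simp [nagR]) (Finset.sum_congr rfl (fun i _ ↦ ?_))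
  rw [add_comm (Polynomial.C _), natDegree_X_pow_add_C, mul_comm]

lemma nag_degreeOf_t_ne_of_ne (hv : v ∈ f.support) (hw : w ∈ f.support) (ne : v ≠ w) :
    (nagT f <| monomial v <| MvPolynomial.coeff v f).degreeOf 0 ≠
    (nagT f <| monomial w <| MvPolynomial.coeff w f).degreeOf 0 := by
  rw [nag_degreeOf_zero_t _ _ <| MvPolynomial.mem_support_iff.mp hv,
    nag_degreeOf_zero_t _ _ <| MvPolynomial.mem_support_iff.mp hw]
  refine nag_sum_r_mul_ne f v w (fun i ↦ ?_) (fun i ↦ ?_) ne <;>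
  exact lt_of_le_of_lt ((monomial_le_degreeOf i ‹_›).trans (degreeOf_le_totalDegree f i))
    (by simp only [nagUp]; lia)

lemma nag_leadingCoeff_finSuccEquiv_t :
    (finSuccEquiv k n ((nagT f) ((monomial v) (MvPolynomial.coeff v f)))).leadingCoeff =
    algebraMap k _ (MvPolynomial.coeff v f) := by
  rw [monomial_eq, Finsupp.prod_fintype]
  · simp only [map_mul, map_prod, leadingCoeff_mul, leadingCoeff_prod]
    rw [AlgEquiv.ofAlgHom_apply, algHom_C, algebraMap_eq, finSuccEquiv_apply,
      eval₂Hom_C, coe_comp]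
    simp only [AlgEquiv.ofAlgHom_apply, Function.comp_apply, leadingCoeff_C, map_pow,
      leadingCoeff_pow, algebraMap_eq]
    have : ∀ j, ((finSuccEquiv k n) ((nagT1 f) 1 (MvPolynomial.X j))).leadingCoeff = 1 := fun j ↦ by
      by_cases h : j = 0
      · simp [h, finSuccEquiv_apply]
      · simp only [aeval_eq_bind₁, bind₁_X_right, if_neg h, one_smul, map_add, map_pow]
        obtain ⟨i, rfl⟩ := Fin.exists_succ_eq.mpr h
        simp [finSuccEquiv_X_succ, finSuccEquiv_X_zero, add_comm]
    simp only [this, one_pow, Finset.prod_const_one, mul_one]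
  exact fun i ↦ pow_zero _

lemma nag_T_leadingcoeff_isUnit (fne : f ≠ 0) :
    IsUnit (finSuccEquiv k n (nagT f f)).leadingCoeff := by
  obtain ⟨v, vin, vs⟩ := Finset.exists_max_image f.support
    (fun v ↦ (nagT f ((monomial v) (MvPolynomial.coeff v f))).degreeOf 0) (support_nonempty.mpr fne)
  set h := fun w ↦ (MvPolynomial.monomial w) (MvPolynomial.coeff w f)
  simp only [← natDegree_finSuccEquiv] at vs
  replace vs : ∀ x ∈ f.support \ {v}, (finSuccEquiv k n ((nagT f) (h x))).degree <
      (finSuccEquiv k n ((nagT f) (h v))).degree := by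
    intro x hx
    obtain ⟨h1, h2⟩ := Finset.mem_sdiff.mp hx
    apply degree_lt_degree <| lt_of_le_of_ne (vs x h1) ?_
    simpa only [natDegree_finSuccEquiv]
      using nag_degreeOf_t_ne_of_ne f _ _ h1 vin <| ne_of_not_mem_cons h2
  have coeff : (finSuccEquiv k n ((nagT f) (h v + ∑ x ∈ f.support \ {v}, h x))).leadingCoeff =
      (finSuccEquiv k n ((nagT f) (h v))).leadingCoeff := by
    simp only [map_add, map_sum]
    rw [add_comm]
    apply leadingCoeff_add_of_degree_lt <| (lt_of_le_of_lt <| degree_sum_le _ _) ?_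
    have h2 : h v ≠ 0 := by simpa [h] using MvPolynomial.mem_support_iff.mp vin
    replace h2 : (finSuccEquiv k n ((nagT f) (h v))) ≠ 0 := fun eq ↦ h2 <|
      by simpa only [map_eq_zero_iff _ (AlgEquiv.injective _)] using eq
    exact (Finset.sup_lt_iff <| Ne.bot_lt (fun x ↦ h2 <| degree_eq_bot.mp x)).mpr vs
  nth_rw 2 [← f.support_sum_monomial_coeff]
  rw [Finset.sum_eq_add_sum_sdiff_singleton_of_mem vin h]
  rw [nag_leadingCoeff_finSuccEquiv_t] at coeff
  simpa only [coeff, algebraMap_eq] using (MvPolynomial.mem_support_iff.mp vin).isUnit.map MvPolynomial.C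
end NagataB

theorem krull_le_of_integral {R S : Type*} [CommRing R] [CommRing S] [Algebra R S]
    [Algebra.IsIntegral R S] (hinj : Function.Injective (algebraMap R S)) :
    ringKrullDim R ≤ ringKrullDim S := by
  refine iSup_le fun l => ?_
  obtain ⟨Q, -, hQ, hQl⟩ := Ideal.exists_ideal_over_prime_of_isIntegral
    (RelSeries.head l).asIdeal (⊥ : Ideal S) (by
      rw [← RingHom.ker_eq_comap_bot, (RingHom.injective_iff_ker_eq_bot _).1 hinj]; exact bot_le)
  have : Q.LiesOver (RelSeries.head l).asIdeal := ⟨hQl.symm⟩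
  obtain ⟨L, hL, -⟩ := Ideal.exists_ltSeries_of_hasGoingUp l Q
  rw [← hL]
  exact le_iSup (fun p : LTSeries (PrimeSpectrum S) => (p.length : WithBot ℕ∞)) L

open Polynomial RingTheory.Sequence in
theorem poly_step {A : Type*} [CommRing A] (I : Ideal A[X]) (p : A[X]) (hp : p.Monic) (hpI : p ∈ I)
    (r : ℕ) (m : WithBot ℕ∞)
    (hdim : ringKrullDim (A[X] ⧸ I) ≤ m)
    (ih : ∀ J : Ideal A, ringKrullDim (A ⧸ J) ≤ m →
      ∃ rs : List A, rs.length = r ∧ IsWeaklyRegular A rs ∧ ∀ x ∈ rs, x ∈ J) :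
    ∃ rs : List A[X], rs.length = r + 1 ∧ IsWeaklyRegular A[X] rs ∧ ∀ x ∈ rs, x ∈ I := by
  obtain ⟨rs, hlen, hreg, hmem⟩ := ih (I.comap (C : A →+* A[X])) (by
    refine le_trans ?_ hdim
    let φ := Ideal.quotientMap I (C : A →+* A[X]) le_rfl
    let := φ.toAlgebra
    have : Algebra.IsIntegral (A ⧸ I.comap (C : A →+* A[X])) (A[X] ⧸ I) := by
      constructor
      intro x
      have h1 : ((Ideal.Quotient.mk I).comp (C : A →+* A[X])).IsIntegral :=
        hp.quotient_isIntegral hpI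
      have h2 : (φ.comp (Ideal.Quotient.mk _)).IsIntegral := by
        exact h1
      exact h2.tower_top _ _ x
    exact krull_le_of_integral Ideal.quotientMap_injective)
  refine ⟨rs.map C ++ [p], by simp [hlen], ?_, ?_⟩
  · rw [isWeaklyRegular_append_iff, isWeaklyRegular_singleton_iff]
    refine ⟨hreg.of_flat (S := A[X]), ?_⟩
    rw [isSMulRegular_iff_right_eq_zero_of_smul]
    intro x
    obtain ⟨h, rfl⟩ := Submodule.Quotient.mk_surjective _ x
    rw [← Submodule.Quotient.mk_smul, Submodule.Quotient.mk_eq_zero, Submodule.Quotient.mk_eq_zero]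
    have : Ideal.ofList (rs.map (C : A →+* A[X])) = (Ideal.ofList rs).map C := by
      rw [Ideal.map_ofList]
    rw [this]
    simp only [smul_eq_mul, Ideal.mul_top]
    have key : ∀ q : A[X], q ∈ (Ideal.ofList rs).map (C : A →+* A[X]) ↔
        q.map (Ideal.Quotient.mk (Ideal.ofList rs)) = 0 := by
      intro q
      rw [Ideal.mem_map_C_iff, Polynomial.ext_iff]
      simp only [Polynomial.coeff_map, Polynomial.coeff_zero, Ideal.Quotient.eq_zero_iff_mem]
    intro hh
    rw [key] at hh ⊢
    rw [Polynomial.map_mul] at hh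
    exact ((hp.map _).mul_right_eq_zero_iff).1 hh
  · intro x hx
    simp only [List.mem_append, List.mem_map, List.mem_singleton] at hx
    rcases hx with ⟨a, ha, rfl⟩ | rfl
    · exact hmem a ha
    · exact hpI

open RingTheory.Sequence in
theorem ringEquiv_weaklyRegular {A B : Type*} [CommRing A] [CommRing B] (e : A ≃+* B)
    (rs : List A) (h : IsWeaklyRegular A rs) : IsWeaklyRegular B (rs.map e) := by
  refine (AddEquiv.isWeaklyRegular_congr (e := e.toAddEquiv) (as := rs) (bs := rs.map e) ?_).1 h
  rw [List.forall₂_map_right_iff, List.forall₂_same]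
  intro x _ y
  simp

theorem krull_quot_comap {A B : Type*} [CommRing A] [CommRing B] (e : A ≃+* B) (I : Ideal B) :
    ringKrullDim (A ⧸ I.comap e.toRingHom) = ringKrullDim (B ⧸ I) :=
  ringKrullDim_eq_of_ringEquiv (Ideal.quotientEquiv _ _ e
    (Ideal.map_comap_of_surjective (e : A →+* B) e.surjective I).symm)

open RingTheory.Sequence in
theorem exists_regular (k : Type*) [Field k] (n : ℕ) (I : Ideal (MvPolynomial (Fin n) k)) (r : ℕ)
    (hr : r ≤ n) (hdim : ringKrullDim (MvPolynomial (Fin n) k ⧸ I) ≤ ((n - r : ℕ) : WithBot ℕ∞)) :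
    ∃ rs : List (MvPolynomial (Fin n) k), rs.length = r ∧
      IsWeaklyRegular (MvPolynomial (Fin n) k) rs ∧ ∀ x ∈ rs, x ∈ I := by
  induction n generalizing r with
  | zero =>
    obtain rfl : r = 0 := by omega
    exact ⟨[], rfl, .nil _ _, by simp⟩
  | succ n ih =>
    cases r with
    | zero => exact ⟨[], rfl, .nil _ _, by simp⟩
    | succ r =>
      have hI : I ≠ ⊥ := by
        rintro rfl
        rw [ringKrullDim_eq_of_ringEquiv (RingEquiv.quotientBot _),
          MvPolynomial.ringKrullDim_of_isNoetherianRing, ringKrullDim_eq_zero_of_field,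
          Nat.card_fin, zero_add, Nat.cast_le] at hdim
        omega
      obtain ⟨f, hf, f0⟩ := Submodule.exists_mem_ne_zero_of_ne_bot hI
      obtain ⟨E, hu⟩ : ∃ E : MvPolynomial (Fin (n + 1)) k ≃+* Polynomial (MvPolynomial (Fin n) k),
          IsUnit (E f).leadingCoeff :=
        ⟨((nagT f).trans (MvPolynomial.finSuccEquiv k n)).toRingEquiv,
          nag_T_leadingcoeff_isUnit f f0⟩
      obtain ⟨rs, hlen, hreg, hmem⟩ := poly_step (I.comap E.symm.toRingHom) _
        (Polynomial.monic_of_isUnit_leadingCoeff_inv_smul hu)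
        (Submodule.smul_of_tower_mem _ hu.unit⁻¹.val (by
          have : E.symm (E f) ∈ I := by simpa using hf
          exact this)) r ((n - r : ℕ) : WithBot ℕ∞) (by
          rw [show n - r = n + 1 - (r + 1) by omega]
          refine le_trans (le_of_eq ?_) hdim
          exact krull_quot_comap E.symm I) (fun J hJ => ih J r (by omega) hJ)
      refine ⟨rs.map E.symm, by simp [hlen], ?_, ?_⟩
      · exact ringEquiv_weaklyRegular E.symm rs hreg
      · intro x hx
        obtain ⟨y, hy, rfl⟩ := List.mem_map.1 hx
        exact hmem y hy

theorem mem_freeGr {k : Type*} [Field k] {n : ℕ} {e : ℤ} {m : ℕ} {j : ℤ}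
    {v : Fin m → MvPolynomial (Fin n) k} :
    v ∈ freeGr k n e m j ↔ ∀ a s, (v a).coeff s ≠ 0 → (s.degree : ℤ) + e = j := by
  unfold freeGr
  split_ifs with h
  · simp only [Submodule.mem_pi, Set.mem_univ, true_imp_iff, MvPolynomial.mem_homogeneousSubmodule,
      MvPolynomial.IsHomogeneous, MvPolynomial.IsWeightedHomogeneous]
    refine forall_congr' fun a => forall_congr' fun s => ?_
    refine imp_congr_right fun _ => ?_
    rw [show Finsupp.weight (1 : Fin n → ℕ) s = s.degree from
      (DFunLike.congr_fun Finsupp.degree_eq_weight_one s).symm]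
    omega
  · rw [Submodule.mem_bot]
    constructor
    · rintro rfl a s h; simp at h
    · intro H
      funext a
      ext s
      by_contra hc
      have := H a s hc
      omega

theorem freeGr_bot {k : Type*} [Field k] {n : ℕ} {e : ℤ} {m : ℕ} {j : ℤ} (h : j < e)
    {v : Fin m → MvPolynomial (Fin n) k} (hv : v ∈ freeGr k n e m j) : v = 0 := by
  rw [mem_freeGr] at hv
  funext a
  ext s
  by_contra hc
  have := hv a s hc
  omega

theorem freeGr_smul {k : Type*} [Field k] {n : ℕ} {e e' : ℤ} {m m' : ℕ} {j j' : ℤ}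
    {v : Fin m → MvPolynomial (Fin n) k} (hv : v ∈ freeGr k n e m j) (a : Fin m)
    {w : Fin m' → MvPolynomial (Fin n) k} (hw : w ∈ freeGr k n e' m' j') :
    v a • w ∈ freeGr k n e' m' (j - e + j') := by
  classical
  rw [mem_freeGr] at *
  intro c s hs
  rw [Pi.smul_apply, smul_eq_mul, MvPolynomial.coeff_mul] at hs
  obtain ⟨⟨x, y⟩, hxy, hne⟩ := Finset.exists_ne_zero_of_sum_ne_zero hs
  rw [Finset.HasAntidiagonal.mem_antidiagonal] at hxy
  have h1 := hv a x (left_ne_zero_of_mul hne)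
  have h2 := hw c y (right_ne_zero_of_mul hne)
  simp only at hxy
  rw [← hxy, map_add]
  push_cast
  omega

theorem freeGr_single {k : Type*} [Field k] {n : ℕ} (e : ℤ) {m : ℕ} (a : Fin m)
    (s : Fin n →₀ ℕ) (c : k) :
    (Pi.single a (MvPolynomial.monomial s c) : Fin m → MvPolynomial (Fin n) k) ∈
      freeGr k n e m (s.degree + e) := by
  classical
  rw [mem_freeGr]
  intro b s' h
  by_cases hb : b = a
  · subst hb
    rw [Pi.single_eq_same, MvPolynomial.coeff_monomial] at h
    by_cases hs : s = s'
    · rw [hs]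
    · simp [hs] at h
  · simp [Pi.single_eq_of_ne hb] at h

theorem freeGr_basis {k : Type*} [Field k] {n : ℕ} (e : ℤ) {m : ℕ} (a : Fin m) :
    (Pi.single a 1 : Fin m → MvPolynomial (Fin n) k) ∈ freeGr k n e m e := by
  have := freeGr_single (n := n) e a 0 (1 : k)
  simpa using this

theorem hom_preimage {k : Type*} [Field k] {n : ℕ} (e : ℤ) {m : ℕ} {N : Type*} [AddCommGroup N]
    [Module (MvPolynomial (Fin n) k) N]
    (L : (Fin m → MvPolynomial (Fin n) k) →ₗ[MvPolynomial (Fin n) k] N)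
    (B : ℤ → Set N) (j : ℤ) (P : N →+ N) (hP : ∀ x ∈ B j, P x = x)
    (hP' : ∀ i, i ≠ j → ∀ x ∈ B i, P x = 0)
    (hL : ∀ i v, v ∈ freeGr k n e m i → L v ∈ B i) (v : Fin m → MvPolynomial (Fin n) k)
    (hv : L v ∈ B j) : ∃ v' ∈ freeGr k n e m j, L v' = L v := by
  classical
  let T : AddSubmonoid (Fin m → MvPolynomial (Fin n) k) :=
    { carrier := {v | ∃ v' ∈ freeGr k n e m j, L v' = P (L v)}
      zero_mem' := ⟨0, Submodule.zero_mem _, by simp⟩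
      add_mem' := by
        rintro x y ⟨x', hx, hx'⟩ ⟨y', hy, hy'⟩
        exact ⟨x' + y', Submodule.add_mem _ hx hy, by simp [hx', hy']⟩ }
  have hT : v ∈ T := by
    rw [← Finset.univ_sum_single v]
    refine sum_mem fun a _ => ?_
    rw [(v a).as_sum]
    have : ∀ (S : Finset (Fin n →₀ ℕ)) (g : (Fin n →₀ ℕ) → MvPolynomial (Fin n) k),
        (Pi.single a (∑ s ∈ S, g s) : Fin m → MvPolynomial (Fin n) k)
          = ∑ s ∈ S, Pi.single a (g s) := fun S g =>
        map_sum (AddMonoidHom.single (fun _ : Fin m => MvPolynomial (Fin n) k) a) g S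
    rw [this]
    refine sum_mem fun s _ => ?_
    have h1 := freeGr_single e a s ((v a).coeff s)
    by_cases h : (s.degree : ℤ) + e = j
    · rw [h] at h1
      exact ⟨_, h1, (hP _ (hL _ _ h1)).symm⟩
    · exact ⟨0, Submodule.zero_mem _, by rw [map_zero, hP' _ h _ (hL _ _ h1)]⟩
  obtain ⟨v', h1, h2⟩ := hT
  exact ⟨v', h1, by rw [h2, hP _ hv]⟩

theorem proj_freeGr (k : Type*) [Field k] (n : ℕ) (e : ℤ) (m : ℕ) (j : ℤ) :
    ∃ P : (Fin m → MvPolynomial (Fin n) k) →+ (Fin m → MvPolynomial (Fin n) k),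
      (∀ x ∈ freeGr k n e m j, P x = x) ∧ ∀ i, i ≠ j → ∀ x ∈ freeGr k n e m i, P x = 0 := by
  classical
  by_cases h : 0 ≤ j - e
  · refine ⟨((MvPolynomial.homogeneousComponent (j - e).toNat).compLeft (Fin m)).toAddMonoidHom,
      fun x hx => ?_, fun i hi x hx => ?_⟩ <;>
    · rw [mem_freeGr] at hx
      funext a
      ext s
      simp only [LinearMap.toAddMonoidHom_coe, LinearMap.compLeft_apply, Function.comp_apply,
        MvPolynomial.coeff_homogeneousComponent, Pi.zero_apply, MvPolynomial.coeff_zero]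
      have := hx a s
      by_cases h0 : MvPolynomial.coeff s (x a) = 0
      · simp [h0]
      · have := hx a s h0
        first
        | rw [if_pos (by omega)]
        | rw [if_neg (by omega)]
  · exact ⟨0, fun x hx => by rw [freeGr_bot (by omega) hx]; rfl, fun _ _ _ _ => rfl⟩

theorem proj_gr {k : Type*} [Field k] {n : ℕ} {M : Type*} [AddCommGroup M]
    [Module (MvPolynomial (Fin n) k) M] [Module k M]
    [IsScalarTower k (MvPolynomial (Fin n) k) M] (gM : GradedMod k n M) (j : ℤ) :
    ∃ P : M →+ M, (∀ x ∈ gM.gr j, P x = x) ∧ ∀ i, i ≠ j → ∀ x ∈ gM.gr i, P x = 0 := by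
  classical
  letI := gM.internal.chooseDecomposition
  refine ⟨AddMonoidHom.mk' (fun x => (DirectSum.decompose gM.gr x j : M)) (by simp),
    fun x hx => ?_, fun i hi x hx => ?_⟩
  · exact DirectSum.decompose_of_mem_same _ hx
  · exact DirectSum.decompose_of_mem_ne _ hx hi

/-- homogeneous on basis implies homogeneous -/
theorem hom_of_basis {k : Type*} [Field k] {n : ℕ} {e e' : ℤ} {m m' : ℕ} {t : ℤ}
    (L : (Fin m → MvPolynomial (Fin n) k) →ₗ[MvPolynomial (Fin n) k]
      (Fin m' → MvPolynomial (Fin n) k))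
    (hL : ∀ a, L (Pi.single a 1) ∈ freeGr k n e' m' (e + t)) (j : ℤ)
    (v : Fin m → MvPolynomial (Fin n) k) (hv : v ∈ freeGr k n e m j) :
    L v ∈ freeGr k n e' m' (j + t) := by
  have : L v = ∑ a, v a • L (Pi.single a 1) := by
    conv_lhs => rw [pi_eq_sum_univ' v]
    simp [map_sum, map_smul, Pi.single_apply, eq_comm]
  rw [this]
  refine Submodule.sum_mem _ fun a _ => ?_
  have := freeGr_smul hv a (hL a)
  rwa [show j - e + (e + t) = j + t by ring] at this

section Assembly
variable {k : Type*} [Field k] {n : ℕ} {M M' : Type*}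
    [AddCommGroup M] [Module (MvPolynomial (Fin n) k) M]
    [Module k M] [IsScalarTower k (MvPolynomial (Fin n) k) M]
    [AddCommGroup M'] [Module (MvPolynomial (Fin n) k) M']
    [Module k M'] [IsScalarTower k (MvPolynomial (Fin n) k) M']
    {gM : GradedMod k n M} {gM' : GradedMod k n M'}
    {ℓ ℓ' : ℕ} {d d' : ℕ → ℤ}
    (RM : PureRes k n M gM ℓ d) (RM' : PureRes k n M' gM' ℓ' d') (t : ℤ)

/-- Good maps at level `i`. -/
def GoodMap (i : ℕ) (f : (Fin (RM'.b i) → MvPolynomial (Fin n) k) →ₗ[MvPolynomial (Fin n) k]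
    (Fin (RM.b i) → MvPolynomial (Fin n) k)) : Prop :=
  (∀ a, f (Pi.single a 1) ∈ freeGr k n (d i) (RM.b i) (d' i + t)) ∧
    ∀ x, f (RM'.δ i x) ∈ LinearMap.range (RM.δ i)

theorem good_zero (φ : M' →ₗ[MvPolynomial (Fin n) k] M)
    (hφhom : ∀ (j : ℤ) (m : M'), m ∈ gM'.gr j → φ m ∈ gM.gr (j + t)) :
    ∃ f, GoodMap RM RM' t 0 f ∧ ∀ x, RM.ε (f x) = φ (RM'.ε x) := by
  obtain ⟨P, hP, hP'⟩ := proj_gr gM (d' 0 + t)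
  obtain ⟨u, hu, hQ⟩ := lift_free RM.ε (φ ∘ₗ RM'.ε)
    (fun v => v ∈ freeGr k n (d 0) (RM.b 0) (d' 0 + t)) (fun a => by
      have h1 : φ (RM'.ε (Pi.single a 1)) ∈ gM.gr (d' 0 + t) :=
        hφhom _ _ (RM'.ε_hom _ _ (freeGr_basis _ _))
      obtain ⟨v, hv⟩ := RM.ε_surj (φ (RM'.ε (Pi.single a 1)))
      obtain ⟨v', h2, h3⟩ := hom_preimage (d 0) RM.ε (fun j => (gM.gr j : Set M)) (d' 0 + t) P
        hP hP' RM.ε_hom v (by rw [hv]; exact h1)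
      exact ⟨v', h2, by rw [h3, hv]; rfl⟩)
  have hu' : ∀ x, RM.ε (u x) = φ (RM'.ε x) := fun x => LinearMap.congr_fun hu x
  refine ⟨u, ⟨hQ, fun x => ?_⟩, hu'⟩
  rw [← RM.exact0, LinearMap.mem_ker, hu']
  have : RM'.δ 0 x ∈ LinearMap.ker RM'.ε := by rw [RM'.exact0]; exact ⟨x, rfl⟩
  rw [LinearMap.mem_ker.1 this, map_zero]

theorem good_succ (i : ℕ) (f) (hf : GoodMap RM RM' t i f) :
    ∃ g, GoodMap RM RM' t (i + 1) g ∧ ∀ x, RM.δ i (g x) = f (RM'.δ i x) := by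
  obtain ⟨P, hP, hP'⟩ := proj_freeGr k n (d i) (RM.b i) (d' (i + 1) + t)
  obtain ⟨u, hu, hQ⟩ := lift_free (RM.δ i) (f ∘ₗ RM'.δ i)
    (fun v => v ∈ freeGr k n (d (i + 1)) (RM.b (i + 1)) (d' (i + 1) + t)) (fun a => by
      have h1 : f (RM'.δ i (Pi.single a 1)) ∈ freeGr k n (d i) (RM.b i) (d' (i + 1) + t) :=
        hom_of_basis f hf.1 _ _ (RM'.δ_hom _ _ _ (freeGr_basis _ _))
      obtain ⟨v, hv⟩ := hf.2 (Pi.single a 1)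
      obtain ⟨v', h2, h3⟩ := hom_preimage (d (i + 1)) (RM.δ i)
        (fun j => (freeGr k n (d i) (RM.b i) j : Set _)) (d' (i + 1) + t) P
        hP hP' (RM.δ_hom i) v (by rw [hv]; exact h1)
      exact ⟨v', h2, by rw [h3, hv]; rfl⟩)
  have hu' : ∀ x, RM.δ i (u x) = f (RM'.δ i x) := fun x => LinearMap.congr_fun hu x
  refine ⟨u, ⟨hQ, fun x => ?_⟩, hu'⟩
  rw [← RM.exact, LinearMap.mem_ker, hu']
  have : RM'.δ (i + 1) x ∈ LinearMap.ker (RM'.δ i) := by rw [RM'.exact]; exact ⟨x, rfl⟩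
  rw [LinearMap.mem_ker.1 this, map_zero]

theorem exists_chain (φ : M' →ₗ[MvPolynomial (Fin n) k] M)
    (hφhom : ∀ (j : ℤ) (m : M'), m ∈ gM'.gr j → φ m ∈ gM.gr (j + t)) :
    ∃ F : ∀ i, (Fin (RM'.b i) → MvPolynomial (Fin n) k) →ₗ[MvPolynomial (Fin n) k]
        (Fin (RM.b i) → MvPolynomial (Fin n) k),
      (∀ i, GoodMap RM RM' t i (F i)) ∧ (∀ x, RM.ε (F 0 x) = φ (RM'.ε x)) ∧
      ∀ i x, RM.δ i (F (i + 1) x) = F i (RM'.δ i x) := by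
  obtain ⟨f0, h0, h0'⟩ := good_zero RM RM' t φ hφhom
  choose G hG hG' using good_succ RM RM' t
  let F : ∀ i, {f // GoodMap RM RM' t i f} := fun i =>
    Nat.rec (motive := fun i => {f // GoodMap RM RM' t i f}) ⟨f0, h0⟩
      (fun i f => ⟨G i f.1 f.2, hG i f.1 f.2⟩) i
  exact ⟨fun i => (F i).1, fun i => (F i).2, h0', fun i x => hG' i (F i).1 (F i).2 x⟩

end Assembly

/-- Over `S = k[x₁,…,xₙ]`, if `M` and `M'` are graded Cohen–Macaulay
`S`-modules with pure resolutions of types `d` (length `ℓ`) and `d'` (length `ℓ'`)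
respectively — Cohen–Macaulayness being recorded, via the Auslander–Buchsbaum formula, as
`dim S/ann = n - ℓ` — and if there is a nonzero homogeneous homomorphism `M' → M` of
degree `t ≤ 0`, then `ℓ' ≤ ℓ` and `d_i ≤ d'_i` for all `i ≤ ℓ'` (the remaining entries of
`d'` being `∞`). -/
theorem stmt3 (k : Type*) [Field k] (n : ℕ)
    (M M' : Type*) [AddCommGroup M] [Module (MvPolynomial (Fin n) k) M]
    [Module k M] [IsScalarTower k (MvPolynomial (Fin n) k) M]
    [AddCommGroup M'] [Module (MvPolynomial (Fin n) k) M']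
    [Module k M'] [IsScalarTower k (MvPolynomial (Fin n) k) M']
    (gM : GradedMod k n M) (gM' : GradedMod k n M')
    (ℓ ℓ' : ℕ) (hℓ : ℓ ≤ n) (hℓ' : ℓ' ≤ n) (d d' : ℕ → ℤ)
    (RM : PureRes k n M gM ℓ d) (RM' : PureRes k n M' gM' ℓ' d')
    (hCM : ringKrullDim
        (MvPolynomial (Fin n) k ⧸ Module.annihilator (MvPolynomial (Fin n) k) M)
      = ((n - ℓ : ℕ) : WithBot ℕ∞))
    (hCM' : ringKrullDim
        (MvPolynomial (Fin n) k ⧸ Module.annihilator (MvPolynomial (Fin n) k) M')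
      = ((n - ℓ' : ℕ) : WithBot ℕ∞))
    (t : ℤ) (ht : t ≤ 0)
    (φ : M' →ₗ[MvPolynomial (Fin n) k] M) (hφ : φ ≠ 0)
    (hφhom : ∀ (j : ℤ) (m : M'), m ∈ gM'.gr j → φ m ∈ gM.gr (j + t)) :
    ℓ' ≤ ℓ ∧ ∀ i ≤ ℓ', d i ≤ d' i := by
  obtain ⟨rs, hlen, hreg, hmem⟩ := exists_regular k n
    (Module.annihilator (MvPolynomial (Fin n) k) M') ℓ' hℓ' hCM'.le
  obtain ⟨F, hF, hF0, hFc⟩ := exists_chain RM RM' t φ hφhom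
  have hcx : ∀ j x, RM.δ j (RM.δ (j + 1) x) = 0 := fun j x => by
    have : RM.δ (j + 1) x ∈ LinearMap.ker (RM.δ j) := by rw [RM.exact]; exact ⟨x, rfl⟩
    exact this
  have key : ∀ i ≤ ℓ', F i ≠ 0 := by
    intro i hi h0
    obtain ⟨u, hu⟩ := chain_zero RM'.b RM'.δ RM'.ε RM'.exact0 RM'.exact rs hreg hmem
      RM.b RM.δ hcx F hFc i (by omega) h0
    apply hφ
    ext m
    obtain ⟨x, rfl⟩ := RM'.ε_surj m
    rw [← hF0, hu, LinearMap.zero_apply]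
    have : RM.δ 0 (u x) ∈ LinearMap.ker RM.ε := by rw [RM.exact0]; exact ⟨_, rfl⟩
    exact this
  constructor
  · by_contra hlt
    refine key ℓ' le_rfl ?_
    have : IsEmpty (Fin (RM.b ℓ')) := by
      rw [RM.bzero ℓ' (by omega)]; infer_instance
    exact LinearMap.ext fun x => Subsingleton.elim _ _
  · intro i hi
    by_contra hlt
    refine key i hi ?_
    refine (Pi.basisFun _ _).ext fun a => ?_
    rw [Pi.basisFun_apply, LinearMap.zero_apply]
    exact freeGr_bot (by omega) ((hF i).1 a)
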